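/- Let T ≥ 1 and r ∈ (0,1). Suppose Δ(i,j) ≥ 0 and c(i,j) ≥ 0 for all i,j, and K ≥ 0. Let τ* be a route whose travel cost satisfies C(τ*) ≤ (3/2)·C(σ) for every route σ. Then for every route σ, π_o(τ*) ≤ (3/2 + r^{1−T})·π_o(σ). (This is the approximation-ratio guarantee of Proposition 3 for the overparameterized case, stated for any route τ* with the travel-cost property guaranteed by Algorithm 1.) -/

import Mathlib

/-- Travel cost of route `τ`: `C(τ) = Σ_{t=1}^{T-1} c(τ_t, τ_{t+1})` (0-indexed). -/
noncomputable def travelCost (T : ℕ) (c : Fin T → Fin T → ℝ) (τ : Equiv.Perm (Fin T)) : ℝ :=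
  ∑ i : Fin T, if h : (i : ℕ) + 1 < T then c (τ i) (τ ⟨(i : ℕ) + 1, h⟩) else 0

/-- Geometrically weighted forgetting term of route `τ` in the overparameterized case:
`Σ_{i=1}^{T} (1−r) r^{T−i} Σ_{j=1}^{T} Δ(τ_i, τ_j)` (0-indexed: exponent `T-1-i`). -/
noncomputable def forgetO (T : ℕ) (r : ℝ) (Δ : Fin T → Fin T → ℝ)
    (τ : Equiv.Perm (Fin T)) : ℝ :=
  ∑ i : Fin T, (1 - r) * r ^ (T - 1 - (i : ℕ)) * ∑ j : Fin T, Δ (τ i) (τ j)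

/-- Overparameterized expected overall loss
`π_o(τ) = (1/T) Σ_i (1−r) r^{T−i} Σ_j Δ(τ_i, τ_j) + (1/T) C(τ) + K`. -/
noncomputable def piO (T : ℕ) (r : ℝ) (Δ c : Fin T → Fin T → ℝ) (K : ℝ)
    (τ : Equiv.Perm (Fin T)) : ℝ :=
  (1 / (T : ℝ)) * forgetO T r Δ τ + (1 / (T : ℝ)) * travelCost T c τ + K

theorem travelCost_nonneg {T : ℕ} {c : Fin T → Fin T → ℝ} (hc : ∀ i j, 0 ≤ c i j)
    (τ : Equiv.Perm (Fin T)) : 0 ≤ travelCost T c τ := by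
  refine Finset.sum_nonneg fun i _ => ?_
  split_ifs
  exacts [hc _ _, le_rfl]

theorem forgetO_nonneg {T : ℕ} {r : ℝ} (hr0 : 0 ≤ r) (hr1 : r ≤ 1) {Δ : Fin T → Fin T → ℝ}
    (hΔ : ∀ i j, 0 ≤ Δ i j) (τ : Equiv.Perm (Fin T)) : 0 ≤ forgetO T r Δ τ :=
  Finset.sum_nonneg fun _ _ => mul_nonneg (mul_nonneg (sub_nonneg.2 hr1) (pow_nonneg hr0 _))
    (Finset.sum_nonneg fun _ _ => hΔ _ _)

/-- The total dissimilarity, summed along a route, does not depend on the route. -/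
theorem sum_sum_perm {T : ℕ} (Δ : Fin T → Fin T → ℝ) (τ : Equiv.Perm (Fin T)) :
    ∑ i, ∑ j, Δ (τ i) (τ j) = ∑ i, ∑ j, Δ i j := by
  simp_rw [fun i => Equiv.sum_comp τ (Δ (τ i))]
  exact Equiv.sum_comp τ fun i => ∑ j, Δ i j

theorem forgetO_le {T : ℕ} {r : ℝ} (hr0 : 0 ≤ r) (hr1 : r ≤ 1) {Δ : Fin T → Fin T → ℝ}
    (hΔ : ∀ i j, 0 ≤ Δ i j) (τ : Equiv.Perm (Fin T)) :
    forgetO T r Δ τ ≤ (1 - r) * ∑ i, ∑ j, Δ i j := by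
  rw [← sum_sum_perm Δ τ, Finset.mul_sum]
  refine Finset.sum_le_sum fun i _ => mul_le_mul_of_nonneg_right ?_
    (Finset.sum_nonneg fun _ _ => hΔ _ _)
  exact mul_le_of_le_one_right (sub_nonneg.2 hr1) (pow_le_one₀ hr0 hr1)

theorem le_forgetO {T : ℕ} {r : ℝ} (hr0 : 0 ≤ r) (hr1 : r ≤ 1) {Δ : Fin T → Fin T → ℝ}
    (hΔ : ∀ i j, 0 ≤ Δ i j) (τ : Equiv.Perm (Fin T)) :
    r ^ (T - 1) * ((1 - r) * ∑ i, ∑ j, Δ i j) ≤ forgetO T r Δ τ := by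
  rw [← sum_sum_perm Δ τ, ← mul_assoc, mul_comm (r ^ (T - 1)), Finset.mul_sum]
  refine Finset.sum_le_sum fun i _ => mul_le_mul_of_nonneg_right ?_
    (Finset.sum_nonneg fun _ _ => hΔ _ _)
  exact mul_le_mul_of_nonneg_left (pow_le_pow_of_le_one hr0 hr1 (Nat.sub_le _ _))
    (sub_nonneg.2 hr1)

/-- The forgetting terms of any two routes differ by a factor of at most `r ^ (1 - T)`. -/
theorem forgetO_le_zpow_mul_forgetO {T : ℕ} (hT : 1 ≤ T) {r : ℝ} (hr0 : 0 < r) (hr1 : r ≤ 1)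
    {Δ : Fin T → Fin T → ℝ} (hΔ : ∀ i j, 0 ≤ Δ i j) (τ σ : Equiv.Perm (Fin T)) :
    forgetO T r Δ τ ≤ r ^ (1 - (T : ℤ)) * forgetO T r Δ σ := by
  have hexp : 1 - (T : ℤ) = -((T - 1 : ℕ) : ℤ) := by omega
  rw [hexp, zpow_neg, zpow_natCast, le_inv_mul_iff₀ (pow_pos hr0 _)]
  exact (mul_le_mul_of_nonneg_left (forgetO_le hr0.le hr1 hΔ τ) (pow_nonneg hr0.le _)).trans
    (le_forgetO hr0.le hr1 hΔ σ)

/-- approximation ratio `3/2 + r^{1−T}` for the overparameterized case. -/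
theorem stmt_1 (T : ℕ) (hT : 1 ≤ T) (r : ℝ) (hr0 : 0 < r) (hr1 : r < 1)
    (Δ c : Fin T → Fin T → ℝ)
    (hΔ : ∀ i j, 0 ≤ Δ i j) (hc : ∀ i j, 0 ≤ c i j) (K : ℝ) (hK : 0 ≤ K)
    (τstar : Equiv.Perm (Fin T))
    (h2 : ∀ σ : Equiv.Perm (Fin T), travelCost T c τstar ≤ (3 / 2) * travelCost T c σ) :
    ∀ σ : Equiv.Perm (Fin T),
      piO T r Δ c K τstar ≤ (3 / 2 + r ^ (1 - (T : ℤ))) * piO T r Δ c K σ := by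
  intro σ
  have hρ : 0 ≤ r ^ (1 - (T : ℤ)) := zpow_nonneg hr0.le _
  have hT0 : (0 : ℝ) ≤ 1 / (T : ℝ) := by positivity
  have hF := mul_le_mul_of_nonneg_left
    (forgetO_le_zpow_mul_forgetO hT hr0 hr1.le hΔ τstar σ) hT0
  have hC := mul_le_mul_of_nonneg_left (h2 σ) hT0
  have hF0 := mul_nonneg hT0 (forgetO_nonneg hr0.le hr1.le hΔ σ)
  have hC0 := mul_nonneg hρ (mul_nonneg hT0 (travelCost_nonneg hc σ))
  have hK0 := mul_nonneg hρ hK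
  unfold piO
  linarith
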